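/- arXiv:1703.01803 — 18 statements merged into one kernel-verified Lean document; each statement's English description precedes it below -/
import Mathlib

section
/- Let A be an integral domain with field of fractions Q(A). A plant p ∈ Q(A) is stabilizable if and only if there exist a, b ∈ A such that a − p·b = 1 and p·a ∈ A. -/
/-- An element of the field of fractions `K` is *stable* if it lies in the
canonical image of the ring `A`. -/
def Stable (A : Type*) {K : Type*} [CommRing A] [IsDomain A] [Field K] [Algebra A K]
    [IsFractionRing A K] (h : K) : Prop :=
  h ∈ (algebraMap A K).range

/-- A controller `c` stabilizes a plant `p` if `p * c ≠ 1` and the three closed-loop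
transfer functions `1/(1 - p*c)`, `p/(1 - p*c)` and `c/(1 - p*c)` are all stable. -/
def Stabilizes (A : Type*) {K : Type*} [CommRing A] [IsDomain A] [Field K] [Algebra A K]
    [IsFractionRing A K] (c p : K) : Prop :=
  p * c ≠ 1 ∧ Stable A (1 - p * c)⁻¹ ∧ Stable A (p * (1 - p * c)⁻¹) ∧
    Stable A (c * (1 - p * c)⁻¹)

theorem stmt0 (A : Type*) {K : Type*} [CommRing A] [IsDomain A] [Field K] [Algebra A K]
    [IsFractionRing A K] (p : K) :
    (∃ c : K, Stabilizes A c p) ↔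
      ∃ a b : A, algebraMap A K a - p * algebraMap A K b = 1 ∧
        Stable A (p * algebraMap A K a) := by
  constructor
  · rintro ⟨c, hpc, ⟨a, ha⟩, ⟨q, hq⟩, ⟨b, hb⟩⟩
    have h : 1 - p * c ≠ 0 := sub_ne_zero.mpr hpc.symm
    refine ⟨a, b, ?_, q, ?_⟩
    · rw [ha, hb]
      field_simp
    · rw [ha, hq]
  · rintro ⟨a, b, hab, q, hq⟩
    by_cases ha : algebraMap A K a = 0
    · have hpb : p * algebraMap A K b = -1 := by linear_combination ha - hab
      have hb : algebraMap A K b ≠ 0 := by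
        intro h
        simp [h] at hpb
      have hinv : (1 - p * (1 - algebraMap A K b))⁻¹ = algebraMap A K b := by
        refine inv_eq_of_mul_eq_one_left ?_
        linear_combination (algebraMap A K b - 1) * hpb
      refine ⟨1 - algebraMap A K b, ?_, ?_, ?_, ?_⟩
      · intro h
        rw [h, sub_self, inv_zero] at hinv
        exact hb hinv.symm
      · exact ⟨b, hinv.symm⟩
      · exact ⟨-1, by rw [hinv, hpb]; simp⟩
      · exact ⟨(1 - b) * b, by rw [hinv]; simp⟩
    · have hinv : (1 - p * (algebraMap A K b / algebraMap A K a))⁻¹ = algebraMap A K a := by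
        refine inv_eq_of_mul_eq_one_left ?_
        field_simp
        exact hab
      refine ⟨algebraMap A K b / algebraMap A K a, ?_, ?_, ?_, ?_⟩
      · intro h
        rw [h, sub_self, inv_zero] at hinv
        exact ha hinv.symm
      · exact ⟨a, hinv.symm⟩
      · exact ⟨q, by rw [hinv, hq]⟩
      · exact ⟨b, by rw [hinv, div_mul_cancel₀ _ ha]⟩
end

section
/- Let A be an integral domain with field of fractions Q(A) and let p ∈ Q(A). A controller c ∈ Q(A) stabilizes p if and only if there exist a, b ∈ A with a ≠ 0 such that a − p·b = 1, p·a ∈ A, and c = b/a. Moreover, in that case a = 1/(1−pc) and b = c/(1−pc). -/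
theorem eq_inv_one_sub_mul_of_sub_eq_one {K : Type*} [Field K] {p c x y : K} (hx : x ≠ 0)
    (h : x - p * y = 1) (hc : c = y / x) :
    x = (1 - p * c)⁻¹ ∧ y = c * (1 - p * c)⁻¹ := by
  have hy : y = c * x := by rw [hc, div_mul_cancel₀ _ hx]
  have hinv : x = (1 - p * c)⁻¹ := by
    apply eq_inv_of_mul_eq_one_left
    rw [hy] at h
    linear_combination h
  exact ⟨hinv, by rw [← hinv, hy]⟩

theorem stmt1 (A : Type*) {K : Type*} [CommRing A] [IsDomain A] [Field K] [Algebra A K]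
    [IsFractionRing A K] (p c : K) :
    (Stabilizes A c p ↔
      ∃ a b : A, a ≠ 0 ∧ algebraMap A K a - p * algebraMap A K b = 1 ∧
        Stable A (p * algebraMap A K a) ∧ c = algebraMap A K b / algebraMap A K a) ∧
    (∀ a b : A, a ≠ 0 → algebraMap A K a - p * algebraMap A K b = 1 →
      Stable A (p * algebraMap A K a) → c = algebraMap A K b / algebraMap A K a →
      algebraMap A K a = (1 - p * c)⁻¹ ∧ algebraMap A K b = c * (1 - p * c)⁻¹) := by
  have key : ∀ a b : A, a ≠ 0 → algebraMap A K a - p * algebraMap A K b = 1 →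
      c = algebraMap A K b / algebraMap A K a →
      algebraMap A K a = (1 - p * c)⁻¹ ∧ algebraMap A K b = c * (1 - p * c)⁻¹ :=
    fun a b ha h hc ↦ eq_inv_one_sub_mul_of_sub_eq_one
      ((map_ne_zero_iff _ (IsFractionRing.injective A K)).mpr ha) h hc
  refine ⟨⟨?_, ?_⟩, fun a b ha h _ hc ↦ key a b ha h hc⟩
  · rintro ⟨hpc, ⟨a, ha⟩, hp, ⟨b, hb⟩⟩
    have hne : 1 - p * c ≠ 0 := sub_ne_zero.mpr hpc.symm
    refine ⟨a, b, ?_, ?_, by rwa [ha], ?_⟩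
    · rintro rfl
      rw [map_zero] at ha
      exact inv_ne_zero hne ha.symm
    · rw [ha, hb]
      linear_combination mul_inv_cancel₀ hne
    · rw [ha, hb, mul_div_cancel_right₀ _ (inv_ne_zero hne)]
  · rintro ⟨a, b, ha, h, hp, hc⟩
    obtain ⟨h₁, h₂⟩ := key a b ha h hc
    have hx : algebraMap A K a ≠ 0 :=
      (map_ne_zero_iff _ (IsFractionRing.injective A K)).mpr ha
    refine ⟨fun hpc ↦ hx ?_, ⟨a, h₁⟩, h₁ ▸ hp, ⟨b, h₂⟩⟩
    rw [h₁, hpc, sub_self, inv_zero]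
end

section
/- Let A be an integral domain with field of fractions Q(A), let p ∈ Q(A), and let a, b ∈ A with a ≠ 0 satisfy a − p·b = 1 and p·a ∈ A. Then a controller c' ∈ Q(A) stabilizes p if and only if there exist q₁, q₂ ∈ A with a + q₁·p·a² + q₂·p·b² ≠ 0 such that c' = (b + q₁·a² + q₂·b²)/(a + q₁·p·a² + q₂·p·b²). -/
theorem stmt2 (A : Type*) {K : Type*} [CommRing A] [IsDomain A] [Field K] [Algebra A K]
    [IsFractionRing A K] (p : K) (a b : A) (ha : a ≠ 0)
    (hab : algebraMap A K a - p * algebraMap A K b = 1)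
    (hpa : Stable A (p * algebraMap A K a)) (c' : K) :
    Stabilizes A c' p ↔
      ∃ q₁ q₂ : A,
        algebraMap A K a + algebraMap A K q₁ * p * (algebraMap A K a) ^ 2 +
            algebraMap A K q₂ * p * (algebraMap A K b) ^ 2 ≠ 0 ∧
        c' = (algebraMap A K b + algebraMap A K q₁ * (algebraMap A K a) ^ 2 +
                algebraMap A K q₂ * (algebraMap A K b) ^ 2) /
             (algebraMap A K a + algebraMap A K q₁ * p * (algebraMap A K a) ^ 2 +
                algebraMap A K q₂ * p * (algebraMap A K b) ^ 2) := by
  obtain ⟨m, hm⟩ := hpa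
  constructor
  · rintro ⟨hne, -, ⟨w, hw⟩, ⟨v, hv⟩⟩
    have hne' : 1 - p * c' ≠ 0 := sub_ne_zero.mpr (Ne.symm hne)
    set D := (1 - p * c')⁻¹ with hD
    have hD0 : D ≠ 0 := inv_ne_zero hne'
    have hDv : D = 1 + p * algebraMap A K v := by
      have h : (1 - p * c') * D = 1 := mul_inv_cancel₀ hne'
      rw [hv]
      linear_combination h
    have hqp : p ^ 2 * (algebraMap A K v - algebraMap A K b) =
        algebraMap A K w - algebraMap A K m := by
      rw [hw, hm]
      linear_combination p * hab - p * hDv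
    have hq : algebraMap A K ((v - b) * (3 - 2 * a)) * algebraMap A K a ^ 2 +
        algebraMap A K ((w - m) * (2 * a + 1)) * algebraMap A K b ^ 2 =
        algebraMap A K v - algebraMap A K b := by
      simp only [map_mul, map_sub, map_add, map_ofNat, map_one]
      rw [← hqp]
      have hpb : p * algebraMap A K b = algebraMap A K a - 1 := by
        linear_combination -hab
      have hpb2 : p ^ 2 * algebraMap A K b ^ 2 = (algebraMap A K a - 1) ^ 2 := by
        rw [← hpb]
        ring
      linear_combination
        (algebraMap A K v - algebraMap A K b) * (2 * algebraMap A K a + 1) * hpb2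
    have hden : algebraMap A K a +
        algebraMap A K ((v - b) * (3 - 2 * a)) * p * algebraMap A K a ^ 2 +
        algebraMap A K ((w - m) * (2 * a + 1)) * p * algebraMap A K b ^ 2 = D := by
      linear_combination p * hq + hab - hDv
    refine ⟨(v - b) * (3 - 2 * a), (w - m) * (2 * a + 1), ?_, ?_⟩
    · rwa [hden]
    · rw [hden, eq_div_iff hD0]
      linear_combination -hv - hq
  · rintro ⟨q₁, q₂, hne, hc⟩
    set D := algebraMap A K a + algebraMap A K q₁ * p * (algebraMap A K a) ^ 2 +
      algebraMap A K q₂ * p * (algebraMap A K b) ^ 2 with hD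
    rw [eq_div_iff hne] at hc
    have h1 : (1 - p * c') * D = 1 := by
      linear_combination -p * hc + hD + hab
    have hinv : (1 - p * c')⁻¹ = D := inv_eq_of_mul_eq_one_right h1
    have hpb : p * algebraMap A K b = algebraMap A K a - 1 := by
      linear_combination -hab
    refine ⟨?_, ?_, ?_, ?_⟩
    · intro h
      simp [h] at h1
    · refine ⟨a + q₁ * m * a + q₂ * (a - 1) * b, ?_⟩
      simp only [map_mul, map_sub, map_add, map_one]
      rw [hinv, hD, hm, ← hpb]
      ring
    · refine ⟨m + q₁ * m ^ 2 + q₂ * (a - 1) ^ 2, ?_⟩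
      simp only [map_mul, map_sub, map_add, map_one, map_pow]
      rw [hinv, hD, hm, ← hpb]
      ring
    · refine ⟨b + q₁ * a ^ 2 + q₂ * b ^ 2, ?_⟩
      simp only [map_mul, map_add, map_pow]
      rw [hinv, hc]
end

section
/- Let A be an integral domain with field of fractions Q(A), let p, Θ ∈ Q(A), and let c ∈ Q(A) be a controller that stabilizes p. Then c is regulating for p with generator Θ (i.e., Θ/(1−pc) ∈ A and Θ·p/(1−pc) ∈ A) if and only if there exist α, β ∈ A such that Θ = α + β·c. -/
theorem stmt3 (A : Type*) {K : Type*} [CommRing A] [IsDomain A] [Field K] [Algebra A K]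
    [IsFractionRing A K] (p Θ c : K) (hc : Stabilizes A c p) :
    (Stable A (Θ * (1 - p * c)⁻¹) ∧ Stable A (Θ * p * (1 - p * c)⁻¹)) ↔
      ∃ α β : A, Θ = algebraMap A K α + algebraMap A K β * c := by
  obtain ⟨hpc, ⟨s, hs⟩, ⟨u, hu⟩, ⟨v, hv⟩⟩ := hc
  have hne : 1 - p * c ≠ 0 := sub_ne_zero.mpr hpc.symm
  have hinv : (1 - p * c) * (1 - p * c)⁻¹ = 1 := mul_inv_cancel₀ hne
  constructor
  · rintro ⟨⟨α, hα⟩, ⟨β, hβ⟩⟩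
    refine ⟨α, -β, ?_⟩
    rw [map_neg, hα, hβ]
    linear_combination -Θ * hinv
  · rintro ⟨α, β, rfl⟩
    refine ⟨⟨α * s + β * v, ?_⟩, ⟨α * u + β * (s - 1), ?_⟩⟩
    · simp only [map_add, map_mul, hs, hv]
      ring
    · simp only [map_add, map_sub, map_mul, map_one, hs, hu]
      linear_combination algebraMap A K β * hinv
end

section
/- Let A be an integral domain with field of fractions Q(A), let p, Θ ∈ Q(A), and let c ∈ Q(A). Then c is robustly regulating for p with generator Θ if and only if c stabilizes p and there exist α, β ∈ A such that Θ = α + β·c (the internal model principle). -/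
/-- A controller `c` is *robustly regulating* for the plant `p` with signal generator `Θ`
if it stabilizes `p` and regulates every plant that it stabilizes. -/
def IsRobustlyRegulating (A : Type*) {K : Type*} [CommRing A] [IsDomain A] [Field K]
    [Algebra A K] [IsFractionRing A K] (Θ p c : K) : Prop :=
  Stabilizes A c p ∧
    ∀ p' : K, Stabilizes A c p' →
      Stable A (Θ * (1 - p' * c)⁻¹) ∧ Stable A (Θ * p' * (1 - p' * c)⁻¹)

theorem stmt4 (A : Type*) {K : Type*} [CommRing A] [IsDomain A] [Field K] [Algebra A K]
    [IsFractionRing A K] (p Θ c : K) :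
    IsRobustlyRegulating A Θ p c ↔
      Stabilizes A c p ∧ ∃ α β : A, Θ = algebraMap A K α + algebraMap A K β * c := by
  constructor
  · rintro ⟨hp, hreg⟩
    refine ⟨hp, ?_⟩
    obtain ⟨⟨α, hα⟩, β, hβ⟩ := hreg p hp
    have hne : 1 - p * c ≠ 0 := sub_ne_zero.mpr hp.1.symm
    refine ⟨α, -β, ?_⟩
    rw [map_neg, hα, hβ]
    linear_combination -Θ * mul_inv_cancel₀ hne
  · rintro ⟨hp, α, β, rfl⟩
    refine ⟨hp, ?_⟩
    rintro p' ⟨hne, ⟨s, hs⟩, ⟨a, ha⟩, b, hb⟩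
    have hinv := mul_inv_cancel₀ (sub_ne_zero.mpr hne.symm)
    refine ⟨⟨α * s + β * b, ?_⟩, α * a + β * (s - 1), ?_⟩
    · simp only [map_add, map_mul, hs, hb]
      ring
    · simp only [map_add, map_sub, map_mul, map_one, hs, ha]
      linear_combination algebraMap A K β * hinv
end

section
/- Let A be an integral domain with field of fractions Q(A) and let p, Θ ∈ Q(A). If a controller c ∈ Q(A) stabilizes p and is regulating for p with generator Θ (i.e., Θ/(1−pc) ∈ A and Θ·p/(1−pc) ∈ A), then c is robustly regulating for p with generator Θ; that is, for every plant p' ∈ Q(A) that c stabilizes, Θ/(1−p'c) ∈ A and Θ·p'/(1−p'c) ∈ A. -/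
theorem stmt5 (A : Type*) {K : Type*} [CommRing A] [IsDomain A] [Field K] [Algebra A K]
    [IsFractionRing A K] (p Θ c : K) (hc : Stabilizes A c p)
    (hreg : Stable A (Θ * (1 - p * c)⁻¹) ∧ Stable A (Θ * p * (1 - p * c)⁻¹)) :
    ∀ p' : K, Stabilizes A c p' →
      Stable A (Θ * (1 - p' * c)⁻¹) ∧ Stable A (Θ * p' * (1 - p' * c)⁻¹) := by
  rintro p' ⟨hp', hs', hps', hcs'⟩
  obtain ⟨hΘ, hΘp⟩ := hreg
  have h : (1 - p * c) * (1 - p * c)⁻¹ = 1 := mul_inv_cancel₀ (sub_ne_zero.2 hc.1.symm)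
  have h' : (1 - p' * c) * (1 - p' * c)⁻¹ = 1 := mul_inv_cancel₀ (sub_ne_zero.2 hp'.symm)
  unfold Stable at *
  constructor
  · convert sub_mem (mul_mem hΘ hs') (mul_mem hΘp hcs') using 1
    linear_combination -Θ * (1 - p' * c)⁻¹ * h
  · convert sub_mem (mul_mem hΘ hps') (mul_mem hΘp (sub_mem hs' (one_mem _))) using 1
    linear_combination -Θ * p' * (1 - p' * c)⁻¹ * h + Θ * p * (1 - p * c)⁻¹ * h'
end

section
/- Let A be an integral domain with field of fractions Q(A), let p ∈ Q(A), and let Θ = γ/θ be a fractional representation of the signal generator Θ ∈ Q(A) (γ, θ ∈ A, θ ≠ 0). If a controller c ∈ Q(A) stabilizes p and there exist α, β ∈ A such that θ·(α + β·c) = 1, then c is robustly regulating for p with generator Θ. -/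
theorem stmt6 (A : Type*) {K : Type*} [CommRing A] [IsDomain A] [Field K] [Algebra A K]
    [IsFractionRing A K] (p Θ : K) (γ θ : A) (hθ : θ ≠ 0)
    (hΘ : Θ = algebraMap A K γ / algebraMap A K θ) (c : K) (hc : Stabilizes A c p)
    (him : ∃ α β : A,
      algebraMap A K θ * (algebraMap A K α + algebraMap A K β * c) = 1) :
    IsRobustlyRegulating A Θ p c := by
  obtain ⟨α, β, h⟩ := him
  have hθK : algebraMap A K θ ≠ 0 := left_ne_zero_of_mul_eq_one h
  have hΘ' : Θ = algebraMap A K γ * (algebraMap A K α + algebraMap A K β * c) := by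
    rw [hΘ, div_eq_iff hθK, mul_assoc, mul_comm _ (algebraMap A K θ), h, mul_one]
  refine ⟨hc, ?_⟩
  rintro p' ⟨hne, ⟨s, hs⟩, ⟨u, hu⟩, ⟨v, hv⟩⟩
  have hinv : (1 - p' * c) * (1 - p' * c)⁻¹ = 1 :=
    mul_inv_cancel₀ (sub_ne_zero.mpr hne.symm)
  refine ⟨⟨γ * (α * s + β * v), ?_⟩, ⟨γ * (α * u + β * (s - 1)), ?_⟩⟩
  · simp only [map_mul, map_add, hs, hv, hΘ']
    ring
  · simp only [map_mul, map_add, map_sub, map_one, hs, hu, hΘ']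
    linear_combination (algebraMap A K γ * algebraMap A K β) * hinv
end

section
/- Let A be an integral domain with field of fractions Q(A), let p ∈ Q(A), and let Θ = γ/θ be a weakly coprime factorization of the signal generator Θ ∈ Q(A). Then a controller c ∈ Q(A) is robustly regulating for p with generator Θ if and only if c stabilizes p and there exist α, β ∈ A such that θ·(α + β·c) = 1. -/
theorem stmt7 (A : Type*) {K : Type*} [CommRing A] [IsDomain A] [Field K] [Algebra A K]
    [IsFractionRing A K] (p Θ : K) (γ θ : A) (hθ : θ ≠ 0)
    (hΘ : Θ = algebraMap A K γ / algebraMap A K θ)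
    (hwc : ∀ k : K, Stable A (k * algebraMap A K γ) → Stable A (k * algebraMap A K θ) →
      Stable A k)
    (c : K) :
    IsRobustlyRegulating A Θ p c ↔
      Stabilizes A c p ∧
        ∃ α β : A, algebraMap A K θ * (algebraMap A K α + algebraMap A K β * c) = 1 := by
  have hθ' : algebraMap A K θ ≠ 0 := by
    simpa using (map_ne_zero_iff _ (IsFractionRing.injective A K)).mpr hθ
  constructor
  · rintro ⟨hs, hr⟩
    refine ⟨hs, ?_⟩
    obtain ⟨h1, h2⟩ := hr p hs
    obtain ⟨hne, ⟨u, hu⟩, ⟨y, hy⟩, -⟩ := hs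
    have hd : 1 - p * c ≠ 0 := fun h => hne (sub_eq_zero.mp h).symm
    obtain ⟨α, hα⟩ := hwc ((1 - p * c)⁻¹ / algebraMap A K θ)
      (by convert h1 using 1; rw [hΘ]; ring) ⟨u, by rw [hu, div_mul_cancel₀ _ hθ']⟩
    obtain ⟨β, hβ⟩ := hwc (p * (1 - p * c)⁻¹ / algebraMap A K θ)
      (by convert h2 using 1; rw [hΘ]; ring) ⟨y, by rw [hy, div_mul_cancel₀ _ hθ']⟩
    refine ⟨α, -β, ?_⟩
    rw [map_neg, hα, hβ]
    field_simp
    ring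
  · rintro ⟨hs, α, β, h⟩
    refine ⟨hs, ?_⟩
    rintro p' ⟨hne, ⟨u, hu⟩, ⟨y, hy⟩, ⟨z, hz⟩⟩
    have hd : 1 - p' * c ≠ 0 := fun h => hne (sub_eq_zero.mp h).symm
    have hΘ' : Θ = algebraMap A K γ * (algebraMap A K α + algebraMap A K β * c) := by
      rw [hΘ, div_eq_iff hθ']
      linear_combination -algebraMap A K γ * h
    refine ⟨⟨γ * (α * u + β * z), ?_⟩, ⟨γ * (α * y + β * (u - 1)), ?_⟩⟩
    · simp only [map_mul, map_add, hu, hz, hΘ']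
      ring
    · simp only [map_mul, map_add, map_sub, map_one, hu, hy, hΘ']
      field_simp
      ring
end

section
/- Let A be an integral domain with field of fractions Q(A), let Θ ∈ Q(A) be a signal generator, let p ∈ Q(A) admit a coprime factorization p = n/d (n, d ∈ A, d ≠ 0, and α·n − β·d = 1 for some α, β ∈ A), and let c ∈ Q(A) stabilize p. Then c is robustly regulating for p with generator Θ if and only if there exist x, y, z ∈ A with x ≠ 0 such that c = y/x, the factorization c = y/x is coprime (i.e., α'·y − β'·x = 1 for some α', β' ∈ A), and Θ = z/x. -/
/-- If the coprime elements `a` and `b` both multiply `t` into `A`, then `t` is stable. -/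
theorem Stable.of_coprime_mul {A K : Type*} [CommRing A] [IsDomain A] [Field K] [Algebra A K]
    [IsFractionRing A K] {a b : A} (hab : ∃ α β : A, α * a - β * b = 1) {t : K}
    (ha : Stable A (algebraMap A K a * t)) (hb : Stable A (algebraMap A K b * t)) :
    Stable A t := by
  obtain ⟨α, β, h⟩ := hab
  obtain ⟨u, hu⟩ := ha
  obtain ⟨v, hv⟩ := hb
  refine ⟨α * u - β * v, ?_⟩
  have h' := congrArg (algebraMap A K) h
  simp only [map_sub, map_mul, map_one] at h' ⊢
  rw [hu, hv]
  linear_combination t * h'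

/-- The complementary sensitivity `p * c / (1 - p * c)` of a stable closed loop is stable. -/
theorem Stabilizes.stable_mul_mul_inv {A K : Type*} [CommRing A] [IsDomain A] [Field K]
    [Algebra A K] [IsFractionRing A K] {c p : K} (h : Stabilizes A c p) :
    Stable A (p * c * (1 - p * c)⁻¹) := by
  have hne : 1 - p * c ≠ 0 := sub_ne_zero.mpr h.1.symm
  have heq : p * c * (1 - p * c)⁻¹ = (1 - p * c)⁻¹ - 1 := by
    field_simp
    ring
  rw [heq]
  exact sub_mem h.2.1 (one_mem _)

theorem stmt8 (A : Type*) {K : Type*} [CommRing A] [IsDomain A] [Field K] [Algebra A K]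
    [IsFractionRing A K] (Θ p : K) (n d : A) (hd : d ≠ 0)
    (hp : p = algebraMap A K n / algebraMap A K d)
    (hcop : ∃ α β : A, α * n - β * d = 1)
    (c : K) (hc : Stabilizes A c p) :
    IsRobustlyRegulating A Θ p c ↔
      ∃ x y z : A, x ≠ 0 ∧ c = algebraMap A K y / algebraMap A K x ∧
        (∃ α' β' : A, α' * y - β' * x = 1) ∧
        Θ = algebraMap A K z / algebraMap A K x := by
  have hd' : algebraMap A K d ≠ 0 := by simpa using hd
  have hne : 1 - p * c ≠ 0 := sub_ne_zero.mpr hc.1.symm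
  have hn : algebraMap A K n = p * algebraMap A K d := by
    rw [hp, div_mul_cancel₀ _ hd']
  constructor
  · rintro ⟨-, hreg⟩
    obtain ⟨hΘ, hΘp⟩ := hreg p hc
    have hden : algebraMap A K d * (1 - p * c) ≠ 0 := mul_ne_zero hd' hne
    obtain ⟨x, hx⟩ : Stable A (algebraMap A K d * (1 - p * c))⁻¹ := by
      refine Stable.of_coprime_mul hcop ?_ ?_
      · convert hc.2.2.1 using 1
        rw [hn]
        field_simp
      · convert hc.2.1 using 1
        field_simp
    obtain ⟨y, hy⟩ : Stable A (c * (algebraMap A K d * (1 - p * c))⁻¹) := by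
      refine Stable.of_coprime_mul hcop ?_ ?_
      · convert hc.stable_mul_mul_inv using 1
        rw [hn]
        field_simp
      · convert hc.2.2.2 using 1
        field_simp
    obtain ⟨z, hz⟩ : Stable A (Θ * (algebraMap A K d * (1 - p * c))⁻¹) := by
      refine Stable.of_coprime_mul hcop ?_ ?_
      · convert hΘp using 1
        rw [hn]
        field_simp
      · convert hΘ using 1
        field_simp
    have hx' : algebraMap A K x ≠ 0 := hx ▸ inv_ne_zero hden
    refine ⟨x, y, z, fun h => hx' (by rw [h, map_zero]), ?_, ⟨-n, -d, ?_⟩, ?_⟩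
    · rw [hy, ← hx, mul_div_cancel_right₀ _ hx']
    · apply IsFractionRing.injective A K
      simp only [map_sub, map_mul, map_neg, map_one]
      rw [hx, hy, hn]
      field_simp
      ring
    · rw [hz, ← hx, mul_div_cancel_right₀ _ hx']
  · rintro ⟨x, y, z, hx, hcx, hxy, hΘ⟩
    refine ⟨hc, fun q hq => ?_⟩
    have hx' : algebraMap A K x ≠ 0 := by simpa using hx
    have hy : algebraMap A K y = c * algebraMap A K x := by
      rw [hcx, div_mul_cancel₀ _ hx']
    have hqne : 1 - q * c ≠ 0 := sub_ne_zero.mpr hq.1.symm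
    have hz : Stable A (algebraMap A K z) := ⟨z, rfl⟩
    have hs : Stable A (algebraMap A K x * (1 - q * c))⁻¹ := by
      refine Stable.of_coprime_mul hxy ?_ ?_
      · convert hq.2.2.2 using 1
        rw [hy]
        field_simp
      · convert hq.2.1 using 1
        field_simp
    have hqs : Stable A (q * (algebraMap A K x * (1 - q * c))⁻¹) := by
      refine Stable.of_coprime_mul hxy ?_ ?_
      · convert hq.stable_mul_mul_inv using 1
        rw [hy]
        field_simp
      · convert hq.2.2.1 using 1
        field_simp
    constructor
    · have heq : Θ * (1 - q * c)⁻¹ = algebraMap A K z * (algebraMap A K x * (1 - q * c))⁻¹ := by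
        rw [hΘ]
        field_simp
      rw [heq]
      exact mul_mem hz hs
    · have heq : Θ * q * (1 - q * c)⁻¹ =
          algebraMap A K z * (q * (algebraMap A K x * (1 - q * c))⁻¹) := by
        rw [hΘ]
        field_simp
      rw [heq]
      exact mul_mem hz hqs
end

section
/- Let A be an integral domain with field of fractions Q(A), let p ∈ A be a stable plant, and let Θ ∈ Q(A) with Θ ≠ 0 be a signal generator. Then there exists a controller that is robustly regulating for p with generator Θ if and only if there exist α, β ∈ A such that α·Θ⁻¹ − β·p = 1 in Q(A). -/
/-- A solution of `α * Θ⁻¹ - β * p = 1` can be replaced by one with `α ≠ 0`: if `α = 0`, then `p`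
is a unit. -/
theorem exists_ne_zero_of_bezout {A K : Type*} [CommRing A] [Field K] [Algebra A K]
    [IsFractionRing A K] {p : A} {Θ : K} (hΘ : Θ ≠ 0)
    (h : ∃ α β : A, algebraMap A K α * Θ⁻¹ - algebraMap A K β * algebraMap A K p = 1) :
    ∃ α β : A, α ≠ 0 ∧ algebraMap A K α * Θ⁻¹ - algebraMap A K β * algebraMap A K p = 1 := by
  obtain ⟨α, β, h⟩ := h
  by_cases hα : α = 0
  · obtain ⟨n, d, hd, rfl⟩ := IsFractionRing.div_surjective (A := A) Θ
    have hn : algebraMap A K n ≠ 0 := fun h0 => hΘ (by rw [h0, zero_div])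
    refine ⟨n, (1 - d) * β, fun h0 => hn (by rw [h0, map_zero]), ?_⟩
    rw [hα, map_zero, zero_mul, zero_sub] at h
    rw [inv_div, mul_div_cancel₀ _ hn, map_mul, map_sub, map_one]
    linear_combination (1 - algebraMap A K d) * h
  · exact ⟨α, β, hα, h⟩

/-- The controller `β / (1 + β * p)` is robustly regulating if `1 + β * p = α / Θ ≠ 0`. -/
theorem isRobustlyRegulating_of_bezout {A K : Type*} [CommRing A] [IsDomain A] [Field K]
    [Algebra A K] [IsFractionRing A K] {p α β : A} {Θ : K} (hΘ : Θ ≠ 0) (hα : α ≠ 0)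
    (h : algebraMap A K α * Θ⁻¹ - algebraMap A K β * algebraMap A K p = 1) :
    IsRobustlyRegulating A Θ (algebraMap A K p)
      (algebraMap A K β / (1 + algebraMap A K β * algebraMap A K p)) := by
  have hα' : algebraMap A K α ≠ 0 := by
    simpa using hα
  have hs : 1 + algebraMap A K β * algebraMap A K p = algebraMap A K α * Θ⁻¹ := by
    linear_combination -h
  have hs0 : 1 + algebraMap A K β * algebraMap A K p ≠ 0 := by
    rw [hs]
    exact mul_ne_zero hα' (inv_ne_zero hΘ)
  have hΘs : Θ * (1 + algebraMap A K β * algebraMap A K p) = algebraMap A K α := by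
    rw [hs]
    field_simp
  set c := algebraMap A K β / (1 + algebraMap A K β * algebraMap A K p) with hc
  have hcs : c * (1 + algebraMap A K β * algebraMap A K p) = algebraMap A K β :=
    div_mul_cancel₀ _ hs0
  have hmul : (1 - algebraMap A K p * c) * (1 + algebraMap A K β * algebraMap A K p) = 1 := by
    linear_combination -algebraMap A K p * hcs
  have hΘ' : Θ = algebraMap A K α * (1 - algebraMap A K p * c) := by
    linear_combination (1 - algebraMap A K p * c) * hΘs - Θ * hmul
  have hinv : (1 - algebraMap A K p * c)⁻¹ = 1 + algebraMap A K β * algebraMap A K p :=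
    inv_eq_of_mul_eq_one_right hmul
  refine ⟨⟨fun h1 => ?_, ?_, ?_, ?_⟩, ?_⟩
  · rw [h1, sub_self, zero_mul] at hmul
    exact zero_ne_one hmul
  · exact ⟨1 + β * p, by simp [hinv]⟩
  · exact ⟨p * (1 + β * p), by simp [hinv]⟩
  · exact ⟨β, by rw [hinv, hcs]⟩
  · rintro p' ⟨hne, ⟨s, hs'⟩, ⟨t, ht⟩, ⟨u, hu⟩⟩
    have hinv' : (1 - p' * c) * (1 - p' * c)⁻¹ = 1 :=
      mul_inv_cancel₀ (sub_ne_zero.mpr hne.symm)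
    refine ⟨⟨α * (s - p * u), ?_⟩, ⟨α * (t - p * (s - 1)), ?_⟩⟩
    · simp only [map_mul, map_sub, hs', hu]
      linear_combination -(1 - p' * c)⁻¹ * hΘ'
    · simp only [map_mul, map_sub, map_one, hs', ht]
      linear_combination -(p' * (1 - p' * c)⁻¹) * hΘ' -
        algebraMap A K α * algebraMap A K p * hinv'

theorem stmt10 (A : Type*) {K : Type*} [CommRing A] [IsDomain A] [Field K] [Algebra A K]
    [IsFractionRing A K] (p : A) (Θ : K) (hΘ : Θ ≠ 0) :
    (∃ c : K, IsRobustlyRegulating A Θ (algebraMap A K p) c) ↔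
      ∃ α β : A,
        algebraMap A K α * Θ⁻¹ - algebraMap A K β * algebraMap A K p = 1 := by
  constructor
  · rintro ⟨c, hstab, hreg⟩
    obtain ⟨α, hα⟩ := (hreg _ hstab).1
    obtain ⟨hne, -, -, β, hβ⟩ := hstab
    have hinv : (1 - algebraMap A K p * c) * (1 - algebraMap A K p * c)⁻¹ = 1 :=
      mul_inv_cancel₀ (sub_ne_zero.mpr hne.symm)
    refine ⟨α, β, ?_⟩
    rw [hα, hβ, mul_right_comm, mul_inv_cancel₀ hΘ]
    linear_combination hinv
  · intro h
    obtain ⟨α, β, hα, h⟩ := exists_ne_zero_of_bezout hΘ h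
    exact ⟨_, isRobustlyRegulating_of_bezout hΘ hα h⟩
end

section
/- Let A be an integral domain with field of fractions Q(A), let p ∈ Q(A), and let c ∈ Q(A) stabilize p. Set a := 1/(1−pc) ∈ A and b := c/(1−pc) ∈ A. If a controller cᵢ ∈ Q(A) stabilizes the stable plant b·p ∈ A, then the controller c_r := c·(1 + cᵢ) stabilizes p. -/
theorem stmt11 (A : Type*) {K : Type*} [CommRing A] [IsDomain A] [Field K] [Algebra A K]
    [IsFractionRing A K] (p c : K) (hc : Stabilizes A c p)
    (a b : K) (ha : a = (1 - p * c)⁻¹) (hb : b = c * (1 - p * c)⁻¹)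
    (cᵢ : K) (hci : Stabilizes A cᵢ (b * p)) :
    Stabilizes A (c * (1 + cᵢ)) p := by
  obtain ⟨hpc, h1, h2, h3⟩ := hc
  obtain ⟨hv, h4, -, h6⟩ := hci
  have hu : 1 - p * c ≠ 0 := sub_ne_zero.mpr hpc.symm
  have hv' : 1 - b * p * cᵢ ≠ 0 := sub_ne_zero.mpr hv.symm
  have key : 1 - p * (c * (1 + cᵢ)) = (1 - p * c) * (1 - b * p * cᵢ) := by
    subst hb
    field_simp
    ring
  refine ⟨fun h => mul_ne_zero hu hv' (by rw [← key, h, sub_self]), ?_, ?_, ?_⟩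
  · rw [key, mul_inv]
    exact mul_mem h1 h4
  · rw [key, mul_inv, ← mul_assoc]
    exact mul_mem h2 h4
  · have e : c * (1 + cᵢ) * (1 - p * (c * (1 + cᵢ)))⁻¹ =
        c * (1 - p * c)⁻¹ * ((1 - b * p * cᵢ)⁻¹ + cᵢ * (1 - b * p * cᵢ)⁻¹) := by
      rw [key, mul_inv]
      ring
    rw [e]
    exact mul_mem h3 (add_mem h4 h6)
end

section
/- Let A be an integral domain with field of fractions Q(A), let p ∈ Q(A), and let c ∈ Q(A) stabilize p. Set a := 1/(1−pc) ∈ A and b := c/(1−pc) ∈ A. Then for every q̃ ∈ A with 1 + b·p·q̃ ≠ 0, the controller c̃(q̃) := c·(1 + q̃/(1 + b·p·q̃)) stabilizes p, and moreover 1/(1 − p·c̃(q̃)) = a·(1 + b·p·q̃). -/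
theorem stmt12 (A : Type*) {K : Type*} [CommRing A] [IsDomain A] [Field K] [Algebra A K]
    [IsFractionRing A K] (p c : K) (hc : Stabilizes A c p)
    (a b : K) (ha : a = (1 - p * c)⁻¹) (hb : b = c * (1 - p * c)⁻¹)
    (qt : A) (hq : 1 + b * p * algebraMap A K qt ≠ 0)
    (ct : K) (hct : ct = c * (1 + algebraMap A K qt / (1 + b * p * algebraMap A K qt))) :
    Stabilizes A ct p ∧ (1 - p * ct)⁻¹ = a * (1 + b * p * algebraMap A K qt) := by
  obtain ⟨hne, hS, hpS, hcS⟩ := hc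
  have hd : 1 - p * c ≠ 0 := sub_ne_zero.mpr hne.symm
  have hda : (1 - p * c) * a = 1 := by rw [ha, mul_inv_cancel₀ hd]
  have hbp : b * p = a - 1 := by
    rw [hb, ← ha]
    linear_combination -hda
  rw [hbp] at hq hct ⊢
  rw [← ha] at hS hpS hcS
  set q := algebraMap A K qt
  have hctu : ct * (1 + (a - 1) * q) = c * (1 + (a - 1) * q + q) := by
    rw [hct, mul_assoc, add_mul, one_mul, div_mul_cancel₀ _ hq]
  have hprod : (1 - p * ct) * (a * (1 + (a - 1) * q)) = 1 := by
    linear_combination -p * a * hctu + (1 + (a - 1) * q + q) * hda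
  have hinv : (1 - p * ct)⁻¹ = a * (1 + (a - 1) * q) := inv_eq_of_mul_eq_one_right hprod
  have hqS : q ∈ (algebraMap A K).range := ⟨qt, rfl⟩
  have hu : 1 + (a - 1) * q ∈ (algebraMap A K).range :=
    add_mem (one_mem _) (mul_mem (sub_mem hS (one_mem _)) hqS)
  refine ⟨⟨fun h => ?_, ?_, ?_, ?_⟩, hinv⟩
  · simp [h] at hprod
  · rw [hinv]
    exact mul_mem hS hu
  · rw [hinv, ← mul_assoc]
    exact mul_mem hpS hu
  · rw [hinv, mul_left_comm, hctu, ← mul_assoc, mul_comm a c]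
    exact mul_mem hcS (add_mem hu hqS)
end

section
/- Let A be an integral domain with field of fractions Q(A), let p, Θ ∈ Q(A), and let c ∈ Q(A) stabilize p. Set a := 1/(1−pc) ∈ A and b := c/(1−pc) ∈ A. If a controller cᵢ ∈ Q(A) is robustly regulating for the stable plant b·p ∈ A with generator Θ, then c_r := c·(1 + cᵢ) is robustly regulating for p with generator Θ. -/
/-- A stabilizing controller that regulates the nominal plant is robustly regulating: with
`α = Θ/(1 - p*c)` and `β = Θ*p/(1 - p*c)` stable, `Θ = α - β*c`. -/
theorem Stabilizes.isRobustlyRegulating {A K : Type*} [CommRing A] [IsDomain A] [Field K]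
    [Algebra A K] [IsFractionRing A K] {Θ p c : K} (hc : Stabilizes A c p)
    (h₁ : Stable A (Θ * (1 - p * c)⁻¹)) (h₂ : Stable A (Θ * p * (1 - p * c)⁻¹)) :
    IsRobustlyRegulating A Θ p c := by
  refine ⟨hc, fun p' ⟨hp', hs, hps, hcs⟩ => ?_⟩
  have hne : 1 - p * c ≠ 0 := sub_ne_zero.mpr hc.1.symm
  have hne' : 1 - p' * c ≠ 0 := sub_ne_zero.mpr hp'.symm
  have hΘ : Θ = Θ * (1 - p * c)⁻¹ - Θ * p * (1 - p * c)⁻¹ * c := by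
    linear_combination -Θ * inv_mul_cancel₀ hne
  unfold Stable at *
  generalize Θ * (1 - p * c)⁻¹ = α at *
  generalize Θ * p * (1 - p * c)⁻¹ = β at *
  subst hΘ
  constructor
  · convert sub_mem (mul_mem h₁ hs) (mul_mem h₂ hcs) using 1
    ring
  · convert sub_mem (mul_mem h₁ hps) (mul_mem h₂ (sub_mem hs (one_mem _))) using 1
    linear_combination β * inv_mul_cancel₀ hne'

theorem stmt13 (A : Type*) {K : Type*} [CommRing A] [IsDomain A] [Field K] [Algebra A K]
    [IsFractionRing A K] (p Θ c : K) (hc : Stabilizes A c p)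
    (a b : K) (ha : a = (1 - p * c)⁻¹) (hb : b = c * (1 - p * c)⁻¹)
    (cᵢ : K) (hci : IsRobustlyRegulating A Θ (b * p) cᵢ) :
    IsRobustlyRegulating A Θ p (c * (1 + cᵢ)) := by
  subst ha hb
  obtain ⟨hpc, hs, hps, hcs⟩ := hc
  obtain ⟨hi, hreg⟩ := hci
  obtain ⟨hΘ, -⟩ := hreg _ hi
  obtain ⟨hpi, his, -, hics⟩ := hi
  have hne : 1 - p * c ≠ 0 := sub_ne_zero.mpr hpc.symm
  have hnei : 1 - c * (1 - p * c)⁻¹ * p * cᵢ ≠ 0 := sub_ne_zero.mpr hpi.symm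
  have hfac : 1 - p * (c * (1 + cᵢ)) = (1 - p * c) * (1 - c * (1 - p * c)⁻¹ * p * cᵢ) := by
    linear_combination p * c * cᵢ * inv_mul_cancel₀ hne
  have hstab : Stabilizes A (c * (1 + cᵢ)) p := by
    refine ⟨fun h => mul_ne_zero hne hnei ?_, ?_⟩
    · rw [← hfac, h, sub_self]
    rw [hfac, mul_inv]
    unfold Stable at *
    refine ⟨mul_mem hs his, ?_, ?_⟩
    · convert mul_mem hps his using 1
      ring
    · convert mul_mem hcs (add_mem his hics) using 1
      ring
  refine hstab.isRobustlyRegulating ?_ ?_ <;> rw [hfac, mul_inv] <;> unfold Stable at *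
  · convert mul_mem hs hΘ using 1
    ring
  · convert mul_mem hps hΘ using 1
    ring
end

section
/- Let A be an integral domain with field of fractions Q(A), let p ∈ Q(A), and let Θ ∈ Q(A) with Θ ≠ 0 be a signal generator. Then there exists a controller that is robustly regulating for p with generator Θ if and only if there exist a, b ∈ A with a ≠ 0 such that a − p·b = 1, p·a ∈ A, and there exist α, β ∈ A with α·Θ⁻¹ − β·b·p = 1 in Q(A). -/
/-- A coprime pair `x - p * y = 1` whose entries `x` and `p * x` absorb `Θ` yields the robustly
regulating controller `y / x`. -/
lemma isRobustlyRegulating_div (A : Type*) {K : Type*} [CommRing A] [IsDomain A] [Field K]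
    [Algebra A K] [IsFractionRing A K] {p Θ x y : K} (hx0 : x ≠ 0) (hxy : x - p * y = 1)
    (hx : Stable A x) (hy : Stable A y) (hpx : Stable A (p * x))
    (hΘx : Stable A (Θ * x)) (hΘpx : Stable A (Θ * (p * x))) :
    IsRobustlyRegulating A Θ p (y / x) := by
  have hinv : 1 - p * (y / x) = x⁻¹ := by
    field_simp
    linear_combination hxy
  refine ⟨⟨fun h => inv_ne_zero hx0 (by rw [← hinv, h, sub_self]), ?_, ?_, ?_⟩, ?_⟩
  · rwa [hinv, inv_inv]
  · rwa [hinv, inv_inv]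
  · rwa [hinv, inv_inv, div_mul_cancel₀ _ hx0]
  rintro q ⟨hne, hu, hqu, hcu⟩
  have hc : x - p * x * (y / x) = 1 := by
    rw [mul_assoc, mul_div_cancel₀ _ hx0, hxy]
  generalize y / x = c at *
  have hu1 : (1 - q * c)⁻¹ - c * (q * (1 - q * c)⁻¹) = 1 := by
    have := inv_mul_cancel₀ (sub_ne_zero.mpr hne.symm)
    linear_combination this
  generalize (1 - q * c)⁻¹ = u at *
  have hcv : Stable A (c * (q * u)) := by
    have h : c * (q * u) = u - 1 := by linear_combination -hu1
    rw [h]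
    exact sub_mem hu (one_mem _)
  constructor
  · have h : Θ * u = Θ * x * u - Θ * (p * x) * (c * u) := by linear_combination -Θ * u * hc
    rw [h]
    exact sub_mem (mul_mem hΘx hu) (mul_mem hΘpx hcu)
  · have h : Θ * q * u = Θ * x * (q * u) - Θ * (p * x) * (c * (q * u)) := by
      linear_combination -Θ * q * u * hc
    rw [h]
    exact sub_mem (mul_mem hΘx hqu) (mul_mem hΘpx hcv)

theorem stmt14 (A : Type*) {K : Type*} [CommRing A] [IsDomain A] [Field K] [Algebra A K]
    [IsFractionRing A K] (p Θ : K) (hΘ : Θ ≠ 0) :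
    (∃ c : K, IsRobustlyRegulating A Θ p c) ↔
      ∃ a b : A, a ≠ 0 ∧ algebraMap A K a - p * algebraMap A K b = 1 ∧
        Stable A (p * algebraMap A K a) ∧
        ∃ α β : A,
          algebraMap A K α * Θ⁻¹ - algebraMap A K β * algebraMap A K b * p = 1 := by
  constructor
  · rintro ⟨c, hs, hreg⟩
    have hne : 1 - p * c ≠ 0 := sub_ne_zero.mpr hs.1.symm
    obtain ⟨⟨α, hα⟩, -⟩ := hreg p hs
    obtain ⟨-, ⟨a, ha⟩, hpa, ⟨b, hb⟩⟩ := hs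
    have hab : algebraMap A K a - p * algebraMap A K b = 1 := by
      rw [ha, hb]
      linear_combination inv_mul_cancel₀ hne
    refine ⟨a, b, ?_, hab, by rwa [ha], α, 1, ?_⟩
    · rintro rfl
      exact inv_ne_zero hne (by rw [← ha, map_zero])
    · rw [hα, ← ha, map_one, mul_right_comm, mul_inv_cancel₀ hΘ]
      linear_combination hab
  · rintro ⟨a, b, ha0, hab, hpa, α, β, hαβ⟩
    have hsta (r : A) : Stable A (algebraMap A K r) := ⟨r, rfl⟩
    have hinj := FaithfulSMul.algebraMap_injective A K
    by_cases hα0 : α = 0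
    · -- Here `p` is the inverse of the stable element `-β * b`.
      obtain ⟨⟨n, s⟩, hs⟩ := IsLocalization.surj (nonZeroDivisors A) Θ
      have hdp : algebraMap A K (-β * b) * p = 1 := by
        rw [hα0, map_zero] at hαβ
        rw [map_mul, map_neg]
        linear_combination hαβ
      generalize -β * b = d at hdp
      have hpx : p * algebraMap A K (d * s) = algebraMap A K s := by
        rw [map_mul]
        linear_combination algebraMap A K s * hdp
      have hd : algebraMap A K d ≠ 0 := left_ne_zero_of_mul_eq_one hdp
      have hs0 : algebraMap A K s ≠ 0 :=
        IsFractionRing.to_map_ne_zero_of_mem_nonZeroDivisors s.2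
      have hΘs : Stable A (Θ * algebraMap A K s) := ⟨n, hs.symm⟩
      refine ⟨_, isRobustlyRegulating_div A (x := algebraMap A K (d * s))
        (y := algebraMap A K (d * (d * s - 1))) ?_ ?_ (hsta _) (hsta _) ?_ ?_ ?_⟩
      · rw [map_mul]
        exact mul_ne_zero hd hs0
      · simp only [map_mul, map_sub, map_one]
        linear_combination (1 - algebraMap A K d * algebraMap A K s) * hdp
      · rw [hpx]
        exact hsta _
      · rw [map_mul, mul_left_comm]
        exact mul_mem (hsta d) hΘs
      · rwa [hpx]
    · have hα : algebraMap A K α ≠ 0 := (map_ne_zero_iff _ hinj).mpr hα0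
      have ha : algebraMap A K a ≠ 0 := (map_ne_zero_iff _ hinj).mpr ha0
      have hx : algebraMap A K a * (algebraMap A K α * Θ⁻¹) =
          algebraMap A K (a * (1 + β * (a - 1))) := by
        simp only [map_mul, map_add, map_sub, map_one]
        linear_combination algebraMap A K a * hαβ - algebraMap A K a * algebraMap A K β * hab
      have hΘx : Θ * algebraMap A K (a * (1 + β * (a - 1))) = algebraMap A K (α * a) := by
        rw [← hx, map_mul]
        field_simp
      refine ⟨_, isRobustlyRegulating_div A (x := algebraMap A K (a * (1 + β * (a - 1))))
        (y := algebraMap A K (b + a * β * b)) ?_ ?_ (hsta _) (hsta _) ?_ ?_ ?_⟩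
      · rw [← hx]
        exact mul_ne_zero ha (mul_ne_zero hα (inv_ne_zero hΘ))
      · simp only [map_mul, map_add, map_sub, map_one]
        linear_combination (1 + algebraMap A K a * algebraMap A K β) * hab
      · rw [map_mul, ← mul_assoc]
        exact mul_mem hpa (hsta _)
      · rw [hΘx]
        exact hsta _
      · rw [mul_left_comm, hΘx, map_mul, mul_left_comm]
        exact mul_mem (hsta α) hpa
end

section
/- Let A be an integral domain with field of fractions Q(A), let p ∈ Q(A), let Θ ∈ Q(A) with Θ ≠ 0 be a signal generator, and let a, b ∈ A with a ≠ 0 satisfy a − p·b = 1 and p·a ∈ A. Then there exists a controller that is robustly regulating for p with generator Θ if and only if there exist α, β, q₁, q₂ ∈ A such that α·Θ⁻¹ − β·(b + q₁·a² + q₂·b²)·p = 1 in Q(A). -/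
/-- If `u` and `p * u` remain stable after multiplication by `Θ`, where `u = 1 + p * v ≠ 0`,
then the controller `v / u` is robustly regulating. -/
theorem isRobustlyRegulating_div_s15 {A K : Type*} [CommRing A] [IsDomain A] [Field K] [Algebra A K]
    [IsFractionRing A K] {p Θ u v : K} (hu0 : u ≠ 0) (huv : u - p * v = 1)
    (hu : Stable A u) (hpu : Stable A (p * u)) (hv : Stable A v)
    (hΘu : Stable A (Θ * u)) (hΘpu : Stable A (Θ * (p * u))) :
    IsRobustlyRegulating A Θ p (v / u) := by
  have hinv : 1 - p * (v / u) = u⁻¹ := by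
    field_simp
    linear_combination huv
  refine ⟨⟨fun h => ?_, ?_, ?_, ?_⟩, fun p' hp' => ?_⟩
  · rw [h, sub_self] at hinv
    exact inv_ne_zero hu0 hinv.symm
  · rwa [hinv, inv_inv]
  · rwa [hinv, inv_inv]
  · rwa [hinv, inv_inv, div_mul_cancel₀ v hu0]
  · obtain ⟨hne, hS, hpS, hcS⟩ := hp'
    obtain ⟨c, hc⟩ : ∃ c, c = v / u := ⟨_, rfl⟩
    have hcu : c * u = v := by rw [hc, div_mul_cancel₀ v hu0]
    rw [← hc] at hne hS hpS hcS ⊢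
    obtain ⟨S, hSdef⟩ : ∃ S, S = (1 - p' * c)⁻¹ := ⟨_, rfl⟩
    have hS1 : (1 - p' * c) * S = 1 := by
      rw [hSdef]
      exact mul_inv_cancel₀ (sub_ne_zero.mpr hne.symm)
    rw [← hSdef] at hS hpS hcS ⊢
    unfold Stable at *
    have key : Θ * (p' * S - p * u) ∈ (algebraMap A K).range := by
      have : Θ * (p' * S - p * u) =
          (p' * S - p * u) * (Θ * u) - (S - u) * (Θ * (p * u)) := by
        linear_combination (-Θ * (p' * S - p * u)) * huv +
          Θ * p * (u * (hS1 - huv + p * hcu) + (p' * S - p * u) * hcu)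
      rw [this]
      exact sub_mem (mul_mem (sub_mem hpS hpu) hΘu) (mul_mem (sub_mem hS hu) hΘpu)
    constructor
    · have : Θ * S = Θ * u + (S - u) * (Θ * u) - (c * S - v) * (Θ * (p * u)) := by
        linear_combination (-Θ * (S - u)) * huv + Θ * p * S * hcu
      rw [this]
      exact sub_mem (add_mem hΘu (mul_mem (sub_mem hS hu) hΘu))
        (mul_mem (sub_mem hcS hv) hΘpu)
    · have : Θ * p' * S = Θ * (p' * S - p * u) + Θ * (p * u) := by ring
      rw [this]
      exact add_mem key hΘpu

theorem stmt15 (A : Type*) {K : Type*} [CommRing A] [IsDomain A] [Field K] [Algebra A K]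
    [IsFractionRing A K] (p Θ : K) (hΘ : Θ ≠ 0) (a b : A) (ha : a ≠ 0)
    (hab : algebraMap A K a - p * algebraMap A K b = 1)
    (hpa : Stable A (p * algebraMap A K a)) :
    (∃ c : K, IsRobustlyRegulating A Θ p c) ↔
      ∃ α β q₁ q₂ : A,
        algebraMap A K α * Θ⁻¹ -
          algebraMap A K β *
            (algebraMap A K b + algebraMap A K q₁ * (algebraMap A K a) ^ 2 +
              algebraMap A K q₂ * (algebraMap A K b) ^ 2) * p = 1 := by
  have mem : ∀ x : A, Stable A (algebraMap A K x) := fun x => ⟨x, rfl⟩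
  unfold Stable at hpa mem
  have hpb : p * algebraMap A K b ∈ (algebraMap A K).range :=
    ⟨a - 1, by rw [map_sub, map_one]; linear_combination hab⟩
  have ha0 : algebraMap A K a ≠ 0 := by
    simpa using ha
  have memA := mem a
  have memB := mem b
  generalize algebraMap A K a = a' at *
  generalize algebraMap A K b = b' at *
  constructor
  · rintro ⟨c, hc, hreg⟩
    obtain ⟨hΘS, -⟩ := hreg p hc
    obtain ⟨hne, hS, hpS, hcS⟩ := hc
    obtain ⟨S, hSdef⟩ : ∃ S, S = (1 - p * c)⁻¹ := ⟨_, rfl⟩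
    have hS1 : (1 - p * c) * S = 1 := by
      rw [hSdef]
      exact mul_inv_cancel₀ (sub_ne_zero.mpr hne.symm)
    rw [← hSdef] at hS hpS hcS hΘS
    unfold Stable at *
    have hr : c * S - b' ∈ (algebraMap A K).range := sub_mem hcS memB
    have hpr : S - a' ∈ (algebraMap A K).range := sub_mem hS memA
    have hppr : p * S - p * a' ∈ (algebraMap A K).range := sub_mem hpS hpa
    obtain ⟨α, hα⟩ := hΘS
    obtain ⟨q₁, hq₁⟩ : (c * S - b') * a' - 3 * b' * (S - a') ∈ (algebraMap A K).range :=
      sub_mem (mul_mem hr memA) (mul_mem (mul_mem (ofNat_mem _ 3) memB) hpr)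
    obtain ⟨q₂, hq₂⟩ : 3 * a' * (p * S - p * a') - (p * S - p * a') * (p * b') ∈
        (algebraMap A K).range :=
      sub_mem (mul_mem (mul_mem (ofNat_mem _ 3) memA) hppr) (mul_mem hppr hpb)
    refine ⟨α, 1, q₁, q₂, ?_⟩
    have hprr : S - a' = p * (c * S - b') := by linear_combination hS1 - hab
    have hcub : c * S - b' = (c * S - b') * (a' - p * b') ^ 3 := by rw [hab]; ring
    have hv : b' + algebraMap A K q₁ * a' ^ 2 + algebraMap A K q₂ * b' ^ 2 = c * S := by
      rw [hq₁, hq₂, show p * S - p * a' = p * (S - a') by ring, hprr]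
      linear_combination -hcub
    rw [hv, hα, map_one]
    field_simp
    linear_combination hS1
  · rintro ⟨α, β, q₁, q₂, h⟩
    obtain ⟨v, hvdef⟩ : ∃ v, v = b' + algebraMap A K q₁ * a' ^ 2 + algebraMap A K q₂ * b' ^ 2 :=
      ⟨_, rfl⟩
    rw [← hvdef] at h
    have hv : v ∈ (algebraMap A K).range := by
      rw [hvdef]
      exact add_mem (add_mem memB (mul_mem (mem _) (pow_mem memA _)))
        (mul_mem (mem _) (pow_mem memB _))
    have hpv : p * v ∈ (algebraMap A K).range := by
      have : p * v = p * b' + algebraMap A K q₁ * a' * (p * a') +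
          algebraMap A K q₂ * b' * (p * b') := by rw [hvdef]; ring
      rw [this]
      exact add_mem (add_mem hpb (mul_mem (mul_mem (mem _) memA) hpa))
        (mul_mem (mul_mem (mem _) memB) hpb)
    have hpu : p * (1 + p * v) ∈ (algebraMap A K).range := by
      have : p * (1 + p * v) = p * a' + algebraMap A K q₁ * (p * a') ^ 2 +
          algebraMap A K q₂ * (p * b') ^ 2 := by
        rw [hvdef]
        linear_combination -p * hab
      rw [this]
      exact add_mem (add_mem hpa (mul_mem (mem _) (pow_mem hpa _)))
        (mul_mem (mem _) (pow_mem hpb _))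
    have hu : 1 + p * v ∈ (algebraMap A K).range := add_mem (one_mem _) hpv
    have hα : Θ * (1 + algebraMap A K β * (p * v)) = algebraMap A K α := by
      field_simp at h
      linear_combination -h
    have hw : v + algebraMap A K β * v * (1 + p * v) ∈ (algebraMap A K).range :=
      add_mem hv (mul_mem (mul_mem (mem _) hv) hu)
    have hy : (1 + p * v) * (1 + algebraMap A K β * (p * v)) ∈ (algebraMap A K).range :=
      mul_mem hu (add_mem (one_mem _) (mul_mem (mem _) hpv))
    have hpy : p * ((1 + p * v) * (1 + algebraMap A K β * (p * v))) ∈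
        (algebraMap A K).range := by
      rw [← mul_assoc]
      exact mul_mem hpu (add_mem (one_mem _) (mul_mem (mem _) hpv))
    have hΘy : Θ * ((1 + p * v) * (1 + algebraMap A K β * (p * v))) ∈
        (algebraMap A K).range := by
      rw [mul_left_comm, hα]
      exact mul_mem hu (mem _)
    have hΘpy : Θ * (p * ((1 + p * v) * (1 + algebraMap A K β * (p * v)))) ∈
        (algebraMap A K).range := by
      rw [← mul_assoc p, mul_left_comm, hα]
      exact mul_mem hpu (mem _)
    have hyw : (1 + p * v) * (1 + algebraMap A K β * (p * v)) -
        p * (v + algebraMap A K β * v * (1 + p * v)) = 1 := by ring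
    generalize (1 + p * v) * (1 + algebraMap A K β * (p * v)) = y at *
    generalize v + algebraMap A K β * v * (1 + p * v) = w at *
    by_cases hy0 : y = 0
    · have hp0 : p ≠ 0 := by
        rintro rfl
        simp [hy0] at hyw
      obtain ⟨x, d, hd, hx⟩ := IsFractionRing.div_surjective (A := A) Θ
      have hd0 : algebraMap A K d ≠ 0 := by
        simpa using nonZeroDivisors.ne_zero hd
      have hΘd : Θ * algebraMap A K d = algebraMap A K x := by
        rw [← hx, div_mul_cancel₀ _ hd0]
      refine ⟨_, isRobustlyRegulating_div_s15 (u := p * a' * (a' * algebraMap A K d))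
        (v := w + a' ^ 2 * algebraMap A K d)
        (mul_ne_zero (mul_ne_zero hp0 ha0) (mul_ne_zero ha0 hd0)) ?_
        (mul_mem hpa (mul_mem memA (mem _))) ?_
        (add_mem hw (mul_mem (pow_mem memA _) (mem _))) ?_ ?_⟩
      · linear_combination hyw - hy0
      · rw [show p * (p * a' * (a' * algebraMap A K d)) = (p * a') ^ 2 * algebraMap A K d by ring]
        exact mul_mem (pow_mem hpa _) (mem _)
      · rw [show Θ * (p * a' * (a' * algebraMap A K d)) =
          p * a' * (a' * (Θ * algebraMap A K d)) by ring, hΘd]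
        exact mul_mem hpa (mul_mem memA (mem _))
      · rw [show Θ * (p * (p * a' * (a' * algebraMap A K d))) =
          (p * a') ^ 2 * (Θ * algebraMap A K d) by ring, hΘd]
        exact mul_mem (pow_mem hpa _) (mem _)
    · exact ⟨_, isRobustlyRegulating_div_s15 hy0 hyw hy hpy hw hΘy hΘpy⟩
end

section
/- Let A be an integral domain with field of fractions Q(A), let p ∈ Q(A), and let Θ = γ/θ be a weakly coprime factorization of the signal generator Θ ∈ Q(A). Then there exists a controller that is robustly regulating for p with generator Θ if and only if p is stabilizable and there exist α, β ∈ A such that α·θ − β·p = 1 in Q(A). -/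
/-- The first coefficient of a Bézout relation between `θ` and `p` may be taken nonzero. -/
theorem exists_ne_zero_bezout {A K : Type*} [CommRing A] [Field K] [Algebra A K]
    {p : K} {θ α β : A}
    (h : algebraMap A K α * algebraMap A K θ - algebraMap A K β * p = 1) :
    ∃ α' β' : A, α' ≠ 0 ∧
      algebraMap A K α' * algebraMap A K θ - algebraMap A K β' * p = 1 := by
  by_cases hα : α = 0
  · subst hα
    rw [map_zero] at h
    refine ⟨β, β - θ * β ^ 2, ?_, ?_⟩
    · rintro rfl
      simp at h
    · simp only [map_sub, map_mul, map_pow]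
      linear_combination (1 - algebraMap A K θ * algebraMap A K β) * h
  · exact ⟨α, β, hα, h⟩

section Regulation

variable {A : Type*} {K : Type*} [CommRing A] [IsDomain A] [Field K] [Algebra A K]
  [IsFractionRing A K]

theorem stable_algebraMap (a : A) : Stable A (algebraMap A K a) :=
  ⟨a, rfl⟩

theorem Stable.add {x y : K} (hx : Stable A x) (hy : Stable A y) : Stable A (x + y) :=
  (algebraMap A K).range.add_mem hx hy

theorem Stable.sub {x y : K} (hx : Stable A x) (hy : Stable A y) : Stable A (x - y) :=
  (algebraMap A K).range.sub_mem hx hy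

theorem Stable.mul {x y : K} (hx : Stable A x) (hy : Stable A y) : Stable A (x * y) :=
  (algebraMap A K).range.mul_mem hx hy

/-- The closed-loop functions `s = (1 - p * c)⁻¹` and `n = c * s` satisfy `s - p * n = 1`. -/
theorem Stabilizes.inv_sub_mul {c p : K} (h : Stabilizes A c p) :
    (1 - p * c)⁻¹ - p * (c * (1 - p * c)⁻¹) = 1 := by
  have hne : 1 - p * c ≠ 0 := sub_ne_zero.2 h.1.symm
  rw [← mul_assoc, ← one_sub_mul, mul_inv_cancel₀ hne]

/-- A solution of `s - p * n = 1` with `s`, `p * s` and `n` stable and `s ≠ 0` yields the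
stabilizing controller `n / s`, whose sensitivity function is `s`. -/
theorem stabilizes_div {p s n : K} (hs0 : s ≠ 0) (hs : Stable A s) (hps : Stable A (p * s))
    (hn : Stable A n) (h : s - p * n = 1) :
    Stabilizes A (n / s) p ∧ (1 - p * (n / s))⁻¹ = s := by
  have key : 1 - p * (n / s) = s⁻¹ := by
    field_simp
    exact h
  have hinv : (1 - p * (n / s))⁻¹ = s := by rw [key, inv_inv]
  refine ⟨⟨fun hpc => ?_, ?_, ?_, ?_⟩, hinv⟩
  · rw [hpc, sub_self] at key
    exact inv_ne_zero hs0 key.symm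
  · rwa [hinv]
  · rwa [hinv]
  · rwa [hinv, div_mul_cancel₀ n hs0]

/-- Regulation of one stabilized plant implies regulation of every stabilized plant. -/
theorem Stabilizes.isRobustlyRegulating_s16 {Θ p c : K} (h : Stabilizes A c p)
    (hΘ : Stable A (Θ * (1 - p * c)⁻¹)) (hΘp : Stable A (Θ * p * (1 - p * c)⁻¹)) :
    IsRobustlyRegulating A Θ p c := by
  have reg (x : K) (hx : Stable A x) (hxc : Stable A (x * c)) : Stable A (Θ * x) := by
    convert (hx.mul hΘ).sub (hxc.mul hΘp) using 1
    linear_combination (-Θ * x) * h.inv_sub_mul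
  refine ⟨h, fun p' h' => ⟨reg _ h'.2.1 ?_, ?_⟩⟩
  · rw [mul_comm]
    exact h'.2.2.2
  · rw [mul_assoc]
    refine reg _ h'.2.2.1 ?_
    convert h'.2.1.sub (stable_algebraMap (1 : A)) using 1
    rw [map_one]
    linear_combination -h'.inv_sub_mul

end Regulation

theorem stmt16 (A : Type*) {K : Type*} [CommRing A] [IsDomain A] [Field K] [Algebra A K]
    [IsFractionRing A K] (p Θ : K) (γ θ : A) (hθ : θ ≠ 0)
    (hΘ : Θ = algebraMap A K γ / algebraMap A K θ)
    (hwc : ∀ k : K, Stable A (k * algebraMap A K γ) → Stable A (k * algebraMap A K θ) →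
      Stable A k) :
    (∃ c : K, IsRobustlyRegulating A Θ p c) ↔
      (∃ c : K, Stabilizes A c p) ∧
        ∃ α β : A, algebraMap A K α * algebraMap A K θ - algebraMap A K β * p = 1 := by
  have hθ' : algebraMap A K θ ≠ 0 := by simpa using hθ
  subst hΘ
  constructor
  · rintro ⟨c, hc, hreg⟩
    obtain ⟨α, hα⟩ : Stable A ((1 - p * c)⁻¹ / algebraMap A K θ) := by
      refine hwc _ ?_ ?_
      · convert (hreg p hc).1 using 1
        ring
      · rw [div_mul_cancel₀ _ hθ']
        exact hc.2.1
    obtain ⟨β, hβ⟩ := hc.2.2.2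
    refine ⟨⟨c, hc⟩, α, β, ?_⟩
    rw [hα, hβ, div_mul_cancel₀ _ hθ', mul_comm _ p]
    exact hc.inv_sub_mul
  · rintro ⟨⟨c, hc⟩, α₀, β₀, h₀⟩
    obtain ⟨α, β, hα, h⟩ := exists_ne_zero_bezout h₀
    have hα' : algebraMap A K α ≠ 0 := by simpa using hα
    have hs₀ : (1 - p * c)⁻¹ ≠ 0 := inv_ne_zero (sub_ne_zero.2 hc.1.symm)
    have hid := hc.inv_sub_mul
    obtain ⟨-, hs, hps, hn⟩ := hc
    generalize c * (1 - p * c)⁻¹ = n at *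
    generalize (1 - p * c)⁻¹ = s at *
    obtain ⟨hstab, hsens⟩ := stabilizes_div (A := A) (p := p)
      (s := algebraMap A K θ * (algebraMap A K α * s)) (n := algebraMap A K β * s + n)
      (mul_ne_zero hθ' (mul_ne_zero hα' hs₀))
      ((stable_algebraMap θ).mul ((stable_algebraMap α).mul hs))
      (by
        convert (stable_algebraMap θ).mul ((stable_algebraMap α).mul hps) using 1
        ring)
      (((stable_algebraMap β).mul hs).add hn)
      (by linear_combination s * h + hid)
    refine ⟨_, hstab.isRobustlyRegulating_s16 ?_ ?_⟩
    · rw [hsens]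
      convert (stable_algebraMap γ).mul ((stable_algebraMap α).mul hs) using 1
      field_simp
    · rw [hsens]
      convert (stable_algebraMap γ).mul ((stable_algebraMap α).mul hps) using 1
      field_simp
end

section
/- Let A be an integral domain with field of fractions Q(A), let p ∈ Q(A), let Θ = γ/θ be a weakly coprime factorization of the signal generator Θ ∈ Q(A), and let c ∈ Q(A) be robustly regulating for p with generator Θ. Set a := 1/(1−pc) and b := θ·c/(1−pc), both of which lie in A. Then a controller c' ∈ Q(A) is robustly regulating for p with generator Θ if and only if there exist q₁, q₂ ∈ A with θ·a + q₁·a²·p + q₂·b²·p ≠ 0 such that c' = (b + q₁·a² + q₂·b²)/(θ·a + q₁·a²·p + q₂·b²·p). -/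
/-- If `c` stabilizes `p`, internal stability together with divisibility of `1/(1 - p*c)` and
`p/(1 - p*c)` by the denominator of the generator characterizes robust regulation. -/
theorem isRobustlyRegulating_iff (A : Type*) {K : Type*} [CommRing A] [IsDomain A] [Field K]
    [Algebra A K] [IsFractionRing A K] {p Θ c : K} {γ θ : A} (hθ : θ ≠ 0)
    (hΘ : Θ = algebraMap A K γ / algebraMap A K θ)
    (hwc : ∀ k : K, Stable A (k * algebraMap A K γ) → Stable A (k * algebraMap A K θ) →
      Stable A k) :
    IsRobustlyRegulating A Θ p c ↔ p * c ≠ 1 ∧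
      (1 - p * c)⁻¹ / algebraMap A K θ ∈ (algebraMap A K).range ∧
      p * (1 - p * c)⁻¹ / algebraMap A K θ ∈ (algebraMap A K).range ∧
      c * (1 - p * c)⁻¹ ∈ (algebraMap A K).range := by
  have ht : algebraMap A K θ ≠ 0 :=
    (map_ne_zero_iff _ (IsFractionRing.injective A K)).2 hθ
  have htm : algebraMap A K θ ∈ (algebraMap A K).range := ⟨θ, rfl⟩
  have hgm : algebraMap A K γ ∈ (algebraMap A K).range := ⟨γ, rfl⟩
  unfold IsRobustlyRegulating Stabilizes
  unfold Stable at *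
  subst hΘ
  generalize algebraMap A K θ = t at *
  generalize algebraMap A K γ = g at *
  generalize (algebraMap A K).range = S at *
  constructor
  · rintro ⟨⟨hpc, h1, h2, h3⟩, h⟩
    obtain ⟨h4, h5⟩ := h p ⟨hpc, h1, h2, h3⟩
    refine ⟨hpc, hwc _ ?_ ?_, hwc _ ?_ ?_, h3⟩
    · convert h4 using 1; ring
    · rwa [div_mul_cancel₀ _ ht]
    · convert h5 using 1; ring
    · rwa [div_mul_cancel₀ _ ht]
  · rintro ⟨hpc, hu, hv, hw⟩
    have h1 := S.mul_mem hu htm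
    have h2 := S.mul_mem hv htm
    rw [div_mul_cancel₀ _ ht] at h1 h2
    refine ⟨⟨hpc, h1, h2, hw⟩, ?_⟩
    rintro p' ⟨hpc', h1', h2', h3'⟩
    have hx : (1 - p * c) * (1 - p * c)⁻¹ = 1 :=
      mul_inv_cancel₀ (sub_ne_zero.2 hpc.symm)
    have hx' : (1 - p' * c) * (1 - p' * c)⁻¹ = 1 :=
      mul_inv_cancel₀ (sub_ne_zero.2 hpc'.symm)
    generalize (1 - p * c)⁻¹ = x at *
    generalize (1 - p' * c)⁻¹ = y at *
    constructor
    · have key : g / t * y = g * (y * (x / t) - c * y * (p * x / t)) := by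
        field_simp
        linear_combination -g * y * hx
      rw [key]
      exact S.mul_mem hgm (S.sub_mem (S.mul_mem h1' hu) (S.mul_mem h3' hv))
    · have key : g / t * p' * y = g * (p' * y * (x / t) - (y - 1) * (p * x / t)) := by
        field_simp
        linear_combination -g * p' * y * hx + g * p * x * hx'
      rw [key]
      exact S.mul_mem hgm (S.sub_mem (S.mul_mem h2' hu)
        (S.mul_mem (S.sub_mem h1' S.one_mem) hv))

theorem stmt18 (A : Type*) {K : Type*} [CommRing A] [IsDomain A] [Field K] [Algebra A K]
    [IsFractionRing A K] (p Θ : K) (γ θ : A) (hθ : θ ≠ 0)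
    (hΘ : Θ = algebraMap A K γ / algebraMap A K θ)
    (hwc : ∀ k : K, Stable A (k * algebraMap A K γ) → Stable A (k * algebraMap A K θ) →
      Stable A k)
    (c : K) (hc : IsRobustlyRegulating A Θ p c)
    (a b : K) (ha : a = (1 - p * c)⁻¹) (hb : b = algebraMap A K θ * c * (1 - p * c)⁻¹) :
    Stable A a ∧ Stable A b ∧
      ∀ c' : K, IsRobustlyRegulating A Θ p c' ↔
        ∃ q₁ q₂ : A,
          algebraMap A K θ * a + algebraMap A K q₁ * a ^ 2 * p +
              algebraMap A K q₂ * b ^ 2 * p ≠ 0 ∧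
          c' = (b + algebraMap A K q₁ * a ^ 2 + algebraMap A K q₂ * b ^ 2) /
               (algebraMap A K θ * a + algebraMap A K q₁ * a ^ 2 * p +
                 algebraMap A K q₂ * b ^ 2 * p) := by
  have ht : algebraMap A K θ ≠ 0 :=
    (map_ne_zero_iff _ (IsFractionRing.injective A K)).2 hθ
  have htm : algebraMap A K θ ∈ (algebraMap A K).range := ⟨θ, rfl⟩
  have hq : ∀ q : A, algebraMap A K q ∈ (algebraMap A K).range := fun q => ⟨q, rfl⟩
  obtain ⟨hpc, hu, hv, hw⟩ := (isRobustlyRegulating_iff A hθ hΘ hwc).1 hc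
  refine ⟨ha ▸ hc.1.2.1, ?_, fun c' => ?_⟩
  · rw [hb, mul_assoc]
    exact Subring.mul_mem _ htm hw
  rw [isRobustlyRegulating_iff A hθ hΘ hwc]
  have hx : (1 - p * c) * (1 - p * c)⁻¹ = 1 := mul_inv_cancel₀ (sub_ne_zero.2 hpc.symm)
  rw [← ha] at hu hv hw hx
  rw [mul_assoc, ← ha] at hb
  rw [mul_div_assoc] at hv
  obtain ⟨u, hua⟩ : ∃ u, a / algebraMap A K θ = u := ⟨_, rfl⟩
  obtain ⟨w, hwa⟩ : ∃ w, c * a = w := ⟨_, rfl⟩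
  rw [hua] at hu hv
  rw [hwa] at hw hb
  obtain rfl : a = u * algebraMap A K θ := (div_eq_iff ht).1 hua
  have hrel : algebraMap A K θ * u - p * w = 1 := by
    rw [← hwa, ← hx]; ring
  clear hx hua hwa ha
  subst hb
  have hpw : p * w ∈ (algebraMap A K).range := by
    rw [show p * w = algebraMap A K θ * u - 1 by linear_combination -hrel]
    exact Subring.sub_mem _ (Subring.mul_mem _ htm hu) (Subring.one_mem _)
  constructor
  · rintro ⟨hpc', hu', hv', hw'⟩
    have hy : (1 - p * c') * (1 - p * c')⁻¹ = 1 :=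
      mul_inv_cancel₀ (sub_ne_zero.2 hpc'.symm)
    have hy0 : (1 - p * c')⁻¹ ≠ 0 := inv_ne_zero (sub_ne_zero.2 hpc'.symm)
    generalize (1 - p * c')⁻¹ = y at *
    obtain ⟨Q, hQ⟩ : ∃ Q, Q = (c' * y - w) / algebraMap A K θ := ⟨_, rfl⟩
    have hQ1 : Q * algebraMap A K θ = c' * y - w := by rw [hQ, div_mul_cancel₀ _ ht]
    have hQ2 : Q * p = y / algebraMap A K θ - u := by
      rw [hQ]; field_simp; linear_combination hrel - hy
    have hm1 : Q * algebraMap A K θ ∈ (algebraMap A K).range := by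
      rw [hQ1]; exact Subring.sub_mem _ hw' hw
    have hm2 : Q * p ^ 2 ∈ (algebraMap A K).range := by
      rw [show Q * p ^ 2 = p * y / algebraMap A K θ - p * u by
        linear_combination p * hQ2]
      exact Subring.sub_mem _ hv' hv
    obtain ⟨q₁, hq₁⟩ : Q * algebraMap A K θ * (algebraMap A K θ ^ 2 * u
        - algebraMap A K 3 * algebraMap A K θ * (p * w)) ∈ (algebraMap A K).range :=
      Subring.mul_mem _ hm1 (Subring.sub_mem _ (Subring.mul_mem _ (Subring.pow_mem _ htm 2) hu)
        (Subring.mul_mem _ (Subring.mul_mem _ (hq 3) htm) hpw))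
    obtain ⟨q₂, hq₂⟩ : Q * p ^ 2 * (algebraMap A K 3 * (algebraMap A K θ * u) - p * w)
        ∈ (algebraMap A K).range :=
      Subring.mul_mem _ hm2 (Subring.sub_mem _
        (Subring.mul_mem _ (hq 3) (Subring.mul_mem _ htm hu)) hpw)
    rw [map_ofNat] at hq₁ hq₂
    have hcube : algebraMap A K q₁ * u ^ 2 + algebraMap A K q₂ * w ^ 2 = Q := by
      rw [hq₁, hq₂]
      calc _ = Q * (algebraMap A K θ * u - p * w) ^ 3 := by ring
        _ = Q := by rw [hrel]; ring
    have hQ3 : algebraMap A K θ * (Q * p) = y - algebraMap A K θ * u := by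
      rw [hQ2]; field_simp
    have hD : algebraMap A K θ * (u * algebraMap A K θ)
        + algebraMap A K q₁ * (u * algebraMap A K θ) ^ 2 * p
        + algebraMap A K q₂ * (algebraMap A K θ * w) ^ 2 * p = algebraMap A K θ * y := by
      linear_combination algebraMap A K θ ^ 2 * p * hcube + algebraMap A K θ * hQ3
    refine ⟨q₁, q₂, ?_, ?_⟩
    · rw [hD]; exact mul_ne_zero ht hy0
    · rw [hD, eq_div_iff (mul_ne_zero ht hy0)]
      linear_combination -algebraMap A K θ ^ 2 * hcube - algebraMap A K θ * hQ1
  · rintro ⟨q₁, q₂, hD, rfl⟩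
    have h₁ := hq q₁
    have h₂ := hq q₂
    generalize algebraMap A K q₁ = r₁ at *
    generalize algebraMap A K q₂ = r₂ at *
    generalize algebraMap A K θ = t at *
    generalize (algebraMap A K).range = S at *
    obtain ⟨Q, hQ⟩ : ∃ Q, Q = r₁ * u ^ 2 + r₂ * w ^ 2 := ⟨_, rfl⟩
    have hDt : t * (u * t) + r₁ * (u * t) ^ 2 * p + r₂ * (t * w) ^ 2 * p
        = t * (t * (u + Q * p)) := by rw [hQ]; ring
    have hNt : t * w + r₁ * (u * t) ^ 2 + r₂ * (t * w) ^ 2 = t * (w + t * Q) := by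
      rw [hQ]; ring
    rw [hDt] at hD
    rw [hDt, hNt, mul_div_mul_left _ _ ht]
    have hD0 : t * (u + Q * p) ≠ 0 := right_ne_zero_of_mul hD
    have hinv : 1 - p * ((w + t * Q) / (t * (u + Q * p))) = (t * (u + Q * p))⁻¹ := by
      refine eq_inv_of_mul_eq_one_left ?_
      rw [sub_mul, mul_assoc p, div_mul_cancel₀ _ hD0]
      linear_combination hrel
    have hQm : Q ∈ S := by
      rw [hQ]
      exact S.add_mem (S.mul_mem h₁ (S.pow_mem hu 2)) (S.mul_mem h₂ (S.pow_mem hw 2))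
    rw [hinv, inv_inv, div_mul_cancel₀ _ hD0, mul_div_cancel_left₀ _ ht]
    refine ⟨fun h => ?_, ?_, ?_, S.add_mem hw (S.mul_mem htm hQm)⟩
    · rw [h, sub_self] at hinv
      exact inv_ne_zero hD0 hinv.symm
    · rw [show u + Q * p = u + (r₁ * u * (p * u) + r₂ * w * (p * w)) by rw [hQ]; ring]
      exact S.add_mem hu (S.add_mem (S.mul_mem (S.mul_mem h₁ hu) hv)
        (S.mul_mem (S.mul_mem h₂ hw) hpw))
    · rw [show p * (t * (u + Q * p)) / t
        = p * u + (r₁ * (p * u) ^ 2 + r₂ * (p * w) ^ 2) by rw [hQ]; field_simp]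
      exact S.add_mem hv (S.add_mem (S.mul_mem h₁ (S.pow_mem hv 2))
        (S.mul_mem h₂ (S.pow_mem hpw 2)))
end

section
/- Let A = ℝ[x², x³] be the subring of the polynomial ring ℝ[x] consisting of polynomials whose coefficient of x is zero, with field of fractions Q(A) = ℝ(x). Consider the plant p = (x³−1)/(x²−1) ∈ Q(A), and set a = (x³+1)/2 ∈ A and b = (x²−1)/2 ∈ A. Then: (i) a − p·b = 1 and p·a ∈ A, so the controller c = b/a = (x²−1)/(x³+1) stabilizes p; and (ii) for the generator Θ = 1/(x⁵−x²+2), taking α = 1/2 ∈ A and β = x² ∈ A gives α·Θ⁻¹ − β·b·p = 1, so there exists a controller that is robustly regulating for p with generator Θ. -/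
/-- The ring `A = ℝ[x², x³]`, realized as the subring of the field of rational functions
`ℝ(x)` consisting of (images of) polynomials whose coefficient of `x` is zero.  Its field
of fractions is `ℝ(x)` itself, here modelled by `RatFunc ℝ`. -/
noncomputable def Rstab : Subring (RatFunc ℝ) where
  carrier := {f | ∃ q : Polynomial ℝ,
    q.coeff 1 = 0 ∧ f = algebraMap (Polynomial ℝ) (RatFunc ℝ) q}
  zero_mem' := ⟨0, by simp, by simp⟩
  one_mem' := ⟨1, by rw [Polynomial.coeff_one]; norm_num, by simp⟩
  add_mem' := by
    rintro x y ⟨p, hp, rfl⟩ ⟨q, hq, rfl⟩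
    exact ⟨p + q, by simp [hp, hq], by simp⟩
  neg_mem' := by
    rintro x ⟨p, hp, rfl⟩
    exact ⟨-p, by simp [hp], by simp⟩
  mul_mem' := by
    rintro x y ⟨p, hp, rfl⟩ ⟨q, hq, rfl⟩
    refine ⟨p * q, ?_, by simp⟩
    rw [Polynomial.coeff_mul]
    simp [Finset.Nat.sum_antidiagonal_eq_sum_range_succ_mk, Finset.sum_range_succ, hp, hq]

/-- An element of `ℝ(x)` is *stable* if it lies in `A = ℝ[x², x³]`. -/
def Stable19 (h : RatFunc ℝ) : Prop := h ∈ Rstab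

/-- A controller `c` stabilizes a plant `p` if `p * c ≠ 1` and the three closed-loop
transfer functions `1/(1 - p*c)`, `p/(1 - p*c)` and `c/(1 - p*c)` are all stable. -/
def Stabilizes19 (c p : RatFunc ℝ) : Prop :=
  p * c ≠ 1 ∧ Stable19 (1 - p * c)⁻¹ ∧ Stable19 (p * (1 - p * c)⁻¹) ∧
    Stable19 (c * (1 - p * c)⁻¹)

/-- A controller `c` is *robustly regulating* for `p` with generator `Θ` if it stabilizes
`p` and regulates every plant it stabilizes. -/
def IsRobustlyRegulating19 (Θ p c : RatFunc ℝ) : Prop :=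
  Stabilizes19 c p ∧
    ∀ p' : RatFunc ℝ, Stabilizes19 c p' →
      Stable19 (Θ * (1 - p' * c)⁻¹) ∧ Stable19 (Θ * p' * (1 - p' * c)⁻¹)

theorem algebraMap_mem_Rstab {q : Polynomial ℝ} (hq : q.coeff 1 = 0) :
    algebraMap (Polynomial ℝ) (RatFunc ℝ) q ∈ Rstab :=
  ⟨q, hq, rfl⟩

theorem ratFunc_X_pow_mem_Rstab {n : ℕ} (hn : n ≠ 1) : (RatFunc.X : RatFunc ℝ) ^ n ∈ Rstab :=
  ⟨Polynomial.X ^ n, by simp [Polynomial.coeff_X_pow, hn.symm], by simp⟩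

theorem ratFunc_half_mem_Rstab : (2⁻¹ : RatFunc ℝ) ∈ Rstab := by
  have h : algebraMap (Polynomial ℝ) (RatFunc ℝ) (Polynomial.C 2⁻¹) = 2⁻¹ := by
    rw [RatFunc.algebraMap_C, map_inv₀, map_ofNat]
  exact h ▸ algebraMap_mem_Rstab (by simp)

theorem ratFunc_ne_zero_of_eval_ne_zero {K : Type*} [Field K] (q : Polynomial K) (t : K)
    {f : RatFunc K} (hf : algebraMap (Polynomial K) (RatFunc K) q = f) (h : q.eval t ≠ 0) :
    f ≠ 0 :=
  hf ▸ RatFunc.algebraMap_ne_zero fun hq => h (by simp [hq])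

theorem one_sub_mul_div_inv {K : Type*} [Field K] {p a b : K} (ha : a ≠ 0)
    (h : a - p * b = 1) : (1 - p * (b / a))⁻¹ = a := by
  rw [inv_eq_iff_eq_inv]
  field_simp
  exact h

/-- A coprime-type factorization `a - p * b = 1` gives the stabilizing controller `b / a`. -/
theorem stabilizes19_div {p a b : RatFunc ℝ} (ha0 : a ≠ 0) (ha : a ∈ Rstab) (hb : b ∈ Rstab)
    (hpa : p * a ∈ Rstab) (h : a - p * b = 1) : Stabilizes19 (b / a) p := by
  have hinv := one_sub_mul_div_inv ha0 h
  refine ⟨fun h1 => ha0 ?_, ?_, ?_, ?_⟩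
  · rw [← hinv, h1, sub_self, inv_zero]
  · rwa [hinv]
  · rwa [hinv]
  · rwa [hinv, div_mul_cancel₀ b ha0]

/-- If moreover `Θ * a` and `Θ * a * p` are stable, then `b / a` is robustly regulating. -/
theorem isRobustlyRegulating19_div {Θ p a b : RatFunc ℝ} (ha0 : a ≠ 0) (ha : a ∈ Rstab)
    (hb : b ∈ Rstab) (hpa : p * a ∈ Rstab) (h : a - p * b = 1) (hΘa : Θ * a ∈ Rstab)
    (hΘap : Θ * a * p ∈ Rstab) : IsRobustlyRegulating19 Θ p (b / a) := by
  refine ⟨stabilizes19_div ha0 ha hb hpa h, ?_⟩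
  rintro p' ⟨hne, hs, hps, hcs⟩
  have hb' : b = b / a * a := (div_mul_cancel₀ b ha0).symm
  generalize b / a = c at *
  subst hb'
  have hunit : (1 - p' * c) * (1 - p' * c)⁻¹ = 1 := mul_inv_cancel₀ (sub_ne_zero.mpr hne.symm)
  generalize (1 - p' * c)⁻¹ = s at *
  have hpcs : p' * (c * s) ∈ Rstab := by
    have : p' * (c * s) = s - 1 := by linear_combination -hunit
    exact this ▸ Rstab.sub_mem hs Rstab.one_mem
  constructor
  · have : Θ * s = Θ * a * s - Θ * a * p * (c * s) := by linear_combination -(Θ * s) * h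
    exact this ▸ Rstab.sub_mem (Rstab.mul_mem hΘa hs) (Rstab.mul_mem hΘap hcs)
  · have : Θ * p' * s = Θ * a * (p' * s) - Θ * a * p * (p' * (c * s)) := by
      linear_combination -(Θ * p' * s) * h
    exact this ▸ Rstab.sub_mem (Rstab.mul_mem hΘa hps) (Rstab.mul_mem hΘap hpcs)

/-- From `a - p * b = 1` and `α * Θ⁻¹ - β * b * p = 1` one obtains a robustly regulating
controller. -/
theorem exists_isRobustlyRegulating19 {Θ p a b α β : RatFunc ℝ} (hΘ0 : Θ ≠ 0) (hα0 : α ≠ 0)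
    (ha0 : a ≠ 0) (hΘ : Θ⁻¹ ∈ Rstab) (ha : a ∈ Rstab) (hb : b ∈ Rstab) (hpa : p * a ∈ Rstab)
    (hα : α ∈ Rstab) (hβ : β ∈ Rstab) (h : a - p * b = 1)
    (hgen : α * Θ⁻¹ - β * b * p = 1) : ∃ c : RatFunc ℝ, IsRobustlyRegulating19 Θ p c := by
  have hαΘ := Rstab.mul_mem hα hΘ
  have hΘa : Θ * (α * Θ⁻¹ * a) = α * a := by field_simp
  refine ⟨_, isRobustlyRegulating19_div (a := α * Θ⁻¹ * a) (b := (α * Θ⁻¹ + β) * b)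
    (mul_ne_zero (mul_ne_zero hα0 (inv_ne_zero hΘ0)) ha0) (Rstab.mul_mem hαΘ ha)
    (Rstab.mul_mem (Rstab.add_mem hαΘ hβ) hb) ?_ ?_ ?_ ?_⟩
  · rw [mul_left_comm]
    exact Rstab.mul_mem hαΘ hpa
  · linear_combination (α * Θ⁻¹) * h + hgen
  · exact hΘa ▸ Rstab.mul_mem hα ha
  · rw [hΘa, mul_assoc, mul_comm a]
    exact Rstab.mul_mem hα hpa

theorem stmt19 (p a b Θ α β c : RatFunc ℝ)
    (hp : p = (RatFunc.X ^ 3 - 1) / (RatFunc.X ^ 2 - 1))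
    (ha : a = (RatFunc.X ^ 3 + 1) / 2)
    (hb : b = (RatFunc.X ^ 2 - 1) / 2)
    (hΘ : Θ = 1 / (RatFunc.X ^ 5 - RatFunc.X ^ 2 + 2))
    (hα : α = 1 / 2) (hβ : β = RatFunc.X ^ 2) (hc : c = b / a) :
    a ∈ Rstab ∧ b ∈ Rstab ∧
    a - p * b = 1 ∧ p * a ∈ Rstab ∧
    c = (RatFunc.X ^ 2 - 1) / (RatFunc.X ^ 3 + 1) ∧ Stabilizes19 c p ∧
    α ∈ Rstab ∧ β ∈ Rstab ∧
    α * Θ⁻¹ - β * b * p = 1 ∧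
    ∃ cᵣ : RatFunc ℝ, IsRobustlyRegulating19 Θ p cᵣ := by
  have hX2 : (RatFunc.X : RatFunc ℝ) ^ 2 - 1 ≠ 0 :=
    ratFunc_ne_zero_of_eval_ne_zero (Polynomial.X ^ 2 - 1) 0 (by simp) (by simp)
  have hX3 : (RatFunc.X : RatFunc ℝ) ^ 3 + 1 ≠ 0 :=
    ratFunc_ne_zero_of_eval_ne_zero (Polynomial.X ^ 3 + 1) 0 (by simp) (by simp)
  have hD : (RatFunc.X : RatFunc ℝ) ^ 5 - RatFunc.X ^ 2 + 2 ≠ 0 :=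
    ratFunc_ne_zero_of_eval_ne_zero (Polynomial.X ^ 5 - Polynomial.X ^ 2 + 2) 0
      (by simp [map_ofNat (algebraMap (Polynomial ℝ) (RatFunc ℝ))]) (by simp)
  have h2 : (2 : RatFunc ℝ) ≠ 0 := two_ne_zero
  have hX (n : ℕ) (hn : n ≠ 1) : (RatFunc.X : RatFunc ℝ) ^ n ∈ Rstab :=
    ratFunc_X_pow_mem_Rstab hn
  have hhalf := ratFunc_half_mem_Rstab
  have ha0 : a ≠ 0 := ha ▸ div_ne_zero hX3 h2
  have haR : a ∈ Rstab := by
    rw [ha, div_eq_mul_inv]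
    exact Rstab.mul_mem (Rstab.add_mem (hX 3 (by simp)) Rstab.one_mem) hhalf
  have hbR : b ∈ Rstab := by
    rw [hb, div_eq_mul_inv]
    exact Rstab.mul_mem (Rstab.sub_mem (hX 2 (by simp)) Rstab.one_mem) hhalf
  have hpb : p * b = (RatFunc.X ^ 3 - 1) / 2 := by
    rw [hp, hb]
    field_simp
  have hab : a - p * b = 1 := by
    rw [hpb, ha]
    field_simp
    ring
  have hpaR : p * a ∈ Rstab := by
    have : p * a = (RatFunc.X ^ 4 + RatFunc.X ^ 2 + 1) * 2⁻¹ := by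
      rw [hp, ha]
      field_simp
      ring
    rw [this]
    exact Rstab.mul_mem (Rstab.add_mem (Rstab.add_mem (hX 4 (by simp)) (hX 2 (by simp)))
      Rstab.one_mem) hhalf
  have hαR : α ∈ Rstab := by rwa [hα, one_div]
  have hβR : β ∈ Rstab := hβ ▸ hX 2 (by simp)
  have hΘinv : Θ⁻¹ = RatFunc.X ^ 5 - RatFunc.X ^ 2 + 2 := by rw [hΘ, one_div, inv_inv]
  have hΘR : Θ⁻¹ ∈ Rstab := by
    rw [hΘinv]
    exact Rstab.add_mem (Rstab.sub_mem (hX 5 (by simp)) (hX 2 (by simp))) (ofNat_mem Rstab 2)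
  have hgen : α * Θ⁻¹ - β * b * p = 1 := by
    rw [mul_assoc, mul_comm b, hpb, hΘinv, hα, hβ]
    field_simp
    ring
  refine ⟨haR, hbR, hab, hpaR, ?_, hc ▸ stabilizes19_div ha0 haR hbR hpaR hab, hαR, hβR, hgen,
    exists_isRobustlyRegulating19 (hΘ ▸ one_div_ne_zero hD) (hα ▸ one_div_ne_zero h2) ha0 hΘR
      haR hbR hpaR hαR hβR hab hgen⟩
  rw [hc, ha, hb, div_div_div_cancel_right₀ h2]
end
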